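/- Let K ≥ 1, T ≥ 1, η > 0, δ > 0 with δη ≤ 1, c_0 ∈ [0,1], and let α_1 ≥ α_2 ≥ … ≥ α_T > 0. Let r_t, c_t ∈ [0,1]^K (t = 1,…,T) be arbitrary, and let c̄_t = (1/t)·Σ_{s=1}^t c_s. Run the high-probability LEWA updates: w_1 = (1,…,1), λ_1 = 0, p_t = w_t/(Σ_j w_{t,j}), w_{t+1,i} = w_{t,i}·exp(η(r_{t,i} + λ_t c̄_{t,i})), λ_{t+1} = [(1 − δη)λ_t − η(p_t·c̄_t + α_t − c_0)]_+. Then for every probability vector p ∈ Δ_K and every λ ≥ 0: Σ_{t=1}^T (p·r_t − p_t·r_t) + λ·Σ_{t=1}^T (c_0 − p_t·c̄_t − α_t) − (δT/2 + 1/(2η))·λ² ≤ (ln K)/η + (13/4 + 2α_1²)·ηT + (η/4 − δ/2)·Σ_{t=1}^T λ_t² + Σ_{t=1}^T λ_t·(c_0 − p·c̄_t − α_t). -/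

import Mathlib

/-- **Hoeffding's lemma** for a finitely supported distribution with weights `p`. -/
theorem sum_mul_exp_le_of_mem_Icc {ι : Type*} [Fintype ι] {p x : ι → ℝ} {b : ℝ}
    (hp : ∀ i, 0 ≤ p i) (hp1 : ∑ i, p i = 1) (hx : ∀ i, x i ∈ Set.Icc 0 b) (s : ℝ) :
    ∑ i, p i * Real.exp (s * x i) ≤ Real.exp (s * ∑ i, p i * x i + s ^ 2 * b ^ 2 / 8) := by
  let _ : MeasurableSpace ι := ⊤
  have hP : ∑ i, ENNReal.ofReal (p i) = 1 := by
    rw [← ENNReal.ofReal_sum_of_nonneg fun i _ => hp i, hp1, ENNReal.ofReal_one]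
  let P : PMF ι := PMF.ofFintype (fun i => ENNReal.ofReal (p i)) hP
  have hint (f : ι → ℝ) : ∫ i, f i ∂P.toMeasure = ∑ i, p i * f i := by
    rw [PMF.integral_eq_sum]
    simp [P, ENNReal.toReal_ofReal, hp]
  have hsub := (ProbabilityTheory.hasSubgaussianMGF_of_mem_Icc (μ := P.toMeasure) (X := x)
    (measurable_from_top.aemeasurable) (Filter.Eventually.of_forall hx)).mgf_le s
  simp only [ProbabilityTheory.mgf, hint] at hsub
  have hc : (((‖b - 0‖₊ / 2) ^ 2 : NNReal) : ℝ) * s ^ 2 / 2 = s ^ 2 * b ^ 2 / 8 := by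
    push_cast
    rw [sub_zero, div_pow, Real.norm_eq_abs, sq_abs]
    ring
  rw [hc] at hsub
  rw [Real.exp_add]
  calc ∑ i, p i * Real.exp (s * x i)
      = Real.exp (s * ∑ i, p i * x i) *
          ∑ i, p i * Real.exp (s * (x i - ∑ i, p i * x i)) := by
        rw [Finset.mul_sum]
        refine Finset.sum_congr rfl fun i _ => ?_
        rw [mul_left_comm, ← Real.exp_add]
        ring_nf
    _ ≤ _ := by gcongr

/-- Regret of exponential weights against a mixture `q`, for gains `x t i ∈ [0, b t]`. -/
theorem exponential_weights_regret {ι : Type*} [Fintype ι] [Nonempty ι] {T : ℕ} {η : ℝ}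
    {x w p : ℕ → ι → ℝ} {b : ℕ → ℝ} (hx : ∀ t < T, ∀ i, x t i ∈ Set.Icc 0 (b t))
    (hw0 : ∀ i, w 0 i = 1) (hp : ∀ t < T, ∀ i, p t i = w t i / ∑ j, w t j)
    (hw : ∀ t < T, ∀ i, w (t + 1) i = w t i * Real.exp (η * x t i))
    {q : ι → ℝ} (hq : ∀ i, 0 ≤ q i) (hq1 : ∑ i, q i = 1) :
    η * ∑ t ∈ Finset.range T, (∑ i, q i * x t i - ∑ i, p t i * x t i)
      ≤ Real.log (Fintype.card ι) + ∑ t ∈ Finset.range T, η ^ 2 * b t ^ 2 / 8 := by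
  have hlogw : ∀ n ≤ T, ∀ i, w n i = Real.exp (η * ∑ t ∈ Finset.range n, x t i) := by
    intro n
    induction n with
    | zero => simp [hw0]
    | succ n ih =>
      intro hn i
      rw [hw n hn, ih (by omega), Finset.sum_range_succ, mul_add, Real.exp_add]
  have hwpos : ∀ n ≤ T, ∀ i, 0 < w n i := fun n hn i => by
    rw [hlogw n hn]
    exact Real.exp_pos _
  have hWpos : ∀ n ≤ T, 0 < ∑ i, w n i := fun n hn =>
    Finset.sum_pos (fun i _ => hwpos n hn i) Finset.univ_nonempty
  have hupper : ∀ n ≤ T, Real.log (∑ i, w n i) ≤ Real.log (Fintype.card ι) +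
      ∑ t ∈ Finset.range n, (η * ∑ i, p t i * x t i + η ^ 2 * b t ^ 2 / 8) := by
    intro n
    induction n with
    | zero => simp [hw0]
    | succ n ih =>
      intro hn
      have hn' : n ≤ T := by omega
      have hW := hWpos n hn'
      have hstep : ∑ i, w (n + 1) i =
          (∑ i, w n i) * ∑ i, p n i * Real.exp (η * x n i) := by
        rw [Finset.mul_sum]
        refine Finset.sum_congr rfl fun i _ => ?_
        rw [hw n hn, hp n hn]
        field_simp
      have hp0 : ∀ i, 0 ≤ p n i := fun i => by
        rw [hp n hn]
        exact (div_pos (hwpos n hn' i) hW).le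
      have hp1 : ∑ i, p n i = 1 := by
        simp_rw [hp n hn]
        rw [← Finset.sum_div, div_self hW.ne']
      have hprod := hWpos (n + 1) hn
      rw [hstep] at hprod
      have hE := pos_of_mul_pos_right hprod hW.le
      have hlog := Real.log_le_log hE (sum_mul_exp_le_of_mem_Icc hp0 hp1 (hx n hn) η)
      rw [Real.log_exp] at hlog
      rw [hstep, Real.log_mul hW.ne' hE.ne', Finset.sum_range_succ]
      linarith [ih hn']
  have hlower : η * ∑ t ∈ Finset.range T, ∑ i, q i * x t i ≤ Real.log (∑ i, w T i) := by
    calc η * ∑ t ∈ Finset.range T, ∑ i, q i * x t i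
        = ∑ i, q i * Real.log (w T i) := by
          rw [Finset.sum_comm, Finset.mul_sum]
          refine Finset.sum_congr rfl fun i _ => ?_
          rw [hlogw T le_rfl, Real.log_exp, ← Finset.mul_sum, mul_left_comm]
      _ ≤ ∑ i, q i * Real.log (∑ j, w T j) := by
          refine Finset.sum_le_sum fun i _ => mul_le_mul_of_nonneg_left ?_ (hq i)
          exact Real.log_le_log (hwpos T le_rfl i)
            (Finset.single_le_sum (fun j _ => (hwpos T le_rfl j).le) (Finset.mem_univ i))
      _ = _ := by rw [← Finset.sum_mul, hq1, one_mul]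
  have h := hupper T le_rfl
  rw [Finset.sum_add_distrib, ← Finset.mul_sum] at h
  rw [Finset.sum_sub_distrib, mul_sub]
  linarith

/-- Regret of regularized projected gradient descent on `[0, ∞)`: the iterates satisfy
`δ * l t ≤ 1`, and compete with every fixed `u ≥ 0`. -/
theorem regularized_gradient_descent_regret {T : ℕ} {η δ a : ℝ} {l y : ℕ → ℝ}
    (hη : 0 < η) (hδ : 0 < δ) (hδη : δ * η ≤ 1)
    (hy : ∀ t < T, y t ∈ Set.Icc (-1) (1 + a)) (hl0 : l 0 = 0)
    (hl : ∀ t < T, l (t + 1) = max 0 ((1 - δ * η) * l t - η * y t)) {u : ℝ} (hu : 0 ≤ u) :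
    ∑ t ∈ Finset.range T, ((l t - u) * y t + δ / 2 * l t ^ 2)
      ≤ (δ * T / 2 + 1 / (2 * η)) * u ^ 2 + (3 + 2 * a ^ 2) * η * T := by
  have hbound : ∀ n ≤ T, 0 ≤ l n ∧ δ * l n ≤ 1 := by
    intro n
    induction n with
    | zero => simp [hl0]
    | succ n ih =>
      intro hn
      obtain ⟨h0, h1⟩ := ih (by omega)
      rw [hl n hn]
      refine ⟨le_max_left _ _, ?_⟩
      rw [mul_max_of_nonneg _ _ hδ.le, mul_zero]
      refine max_le zero_le_one ?_
      nlinarith [mul_le_mul_of_nonneg_left h1 (sub_nonneg.2 hδη),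
        mul_le_mul_of_nonneg_left (hy n hn).1 (mul_pos hδ hη).le]
  have hpot : ∀ n ≤ T, ∑ t ∈ Finset.range n, ((l t - u) * y t + δ / 2 * l t ^ 2)
      ≤ δ * n / 2 * u ^ 2 + (u ^ 2 - (l n - u) ^ 2) / (2 * η) + (3 + 2 * a ^ 2) * η * n := by
    intro n
    induction n with
    | zero => simp [hl0]
    | succ n ih =>
      intro hn
      obtain ⟨h0, h1⟩ := hbound n (by omega)
      obtain ⟨hy0, hy1⟩ := hy n hn
      have hδl : 0 ≤ δ * l n := by positivity
      set g := δ * l n + y n with hg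
      have hg2 : g ^ 2 ≤ 6 + 4 * a ^ 2 := by
        have hg0 : -1 ≤ g := by linarith
        have hg1 : g ≤ 2 + a := by linarith
        rcases le_total g 0 with h | h
        · nlinarith [sq_nonneg a]
        · nlinarith [sq_nonneg (3 * a - 2), pow_le_pow_left₀ h hg1 2]
      have hproj : (l (n + 1) - u) ^ 2 ≤ (l n - η * g - u) ^ 2 := by
        have : l (n + 1) = max 0 (l n - η * g) := by
          rw [hl n hn, hg]
          ring_nf
        rw [this]
        rcases le_total 0 (l n - η * g) with h | h
        · rw [max_eq_right h]
        · rw [max_eq_left h]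
          nlinarith
      have hstep : (l n - u) * y n + δ / 2 * l n ^ 2 ≤ δ / 2 * u ^ 2 +
          ((l n - u) ^ 2 - (l (n + 1) - u) ^ 2) / (2 * η) + (3 + 2 * a ^ 2) * η := by
        have hgrad : (l n - u) * g - η * g ^ 2 / 2 ≤
            ((l n - u) ^ 2 - (l (n + 1) - u) ^ 2) / (2 * η) := by
          rw [le_div_iff₀ (by positivity)]
          nlinarith
        have hgη := mul_le_mul_of_nonneg_left hg2 hη.le
        have hsq := mul_nonneg hδ.le (sq_nonneg (l n - u))
        rw [hg] at hgrad hgη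
        nlinarith
      rw [Finset.sum_range_succ]
      have := ih (by omega)
      rw [sub_div] at this hstep ⊢
      push_cast
      linarith
  have hlast : (u ^ 2 - (l T - u) ^ 2) / (2 * η) ≤ 1 / (2 * η) * u ^ 2 := by
    rw [div_mul_eq_mul_div, one_mul]
    gcongr
    linarith [sq_nonneg (l T - u)]
  linarith [hpot T le_rfl]


/-- Deterministic combined primal–dual inequality for the high-probability LEWA algorithm.
Rounds `t = 1, …, T` are indexed by `t = 0, …, T-1` (so `α_1` becomes `α 0` and
`c̄_t = (1/t)·Σ_{s=1}^t c_s` becomes `cb t = (Σ_{s=0}^t c s)/(t+1)`). -/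
theorem hp_lewa_primal_dual_inequality (K T : ℕ) (hK : 1 ≤ K) (hT : 1 ≤ T)
    (η δ c0 : ℝ) (hη : 0 < η) (hδ : 0 < δ) (hδη : δ * η ≤ 1)
    (hc0 : c0 ∈ Set.Icc (0 : ℝ) 1)
    (α : ℕ → ℝ) (hαpos : ∀ t < T, 0 < α t)
    (hαmono : ∀ s t : ℕ, s ≤ t → t < T → α t ≤ α s)
    (r c : ℕ → Fin K → ℝ)
    (hr : ∀ t < T, ∀ i, r t i ∈ Set.Icc (0 : ℝ) 1)
    (hc : ∀ t < T, ∀ i, c t i ∈ Set.Icc (0 : ℝ) 1)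
    (cb : ℕ → Fin K → ℝ)
    (hcb : ∀ t < T, ∀ i, cb t i = (∑ s ∈ Finset.range (t + 1), c s i) / (t + 1))
    (w : ℕ → Fin K → ℝ) (lam : ℕ → ℝ) (p : ℕ → Fin K → ℝ)
    (hw0 : ∀ i, w 0 i = 1) (hlam0 : lam 0 = 0)
    (hp : ∀ t < T, ∀ i, p t i = w t i / ∑ j, w t j)
    (hwrec : ∀ t < T, ∀ i,
      w (t + 1) i = w t i * Real.exp (η * (r t i + lam t * cb t i)))
    (hlamrec : ∀ t < T,
      lam (t + 1) = max 0 ((1 - δ * η) * lam t - η * ((∑ i, p t i * cb t i) + α t - c0)))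
    (q : Fin K → ℝ) (hq : ∀ i, 0 ≤ q i) (hq1 : ∑ i, q i = 1)
    (lamb : ℝ) (hlamb : 0 ≤ lamb) :
    ∑ t ∈ Finset.range T, ((∑ i, q i * r t i) - ∑ i, p t i * r t i)
      + lamb * ∑ t ∈ Finset.range T, (c0 - (∑ i, p t i * cb t i) - α t)
      - (δ * T / 2 + 1 / (2 * η)) * lamb ^ 2
      ≤ Real.log K / η + (13 / 4 + 2 * α 0 ^ 2) * η * T
        + (η / 4 - δ / 2) * ∑ t ∈ Finset.range T, lam t ^ 2
        + ∑ t ∈ Finset.range T, lam t * (c0 - (∑ i, q i * cb t i) - α t) := by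
  have : Nonempty (Fin K) := ⟨⟨0, hK⟩⟩
  have hlam : ∀ t < T, 0 ≤ lam t := fun t ht => by
    cases t with
    | zero => exact hlam0.ge
    | succ n =>
      rw [hlamrec n (by omega)]
      exact le_max_left _ _
  have hcbmem : ∀ t < T, ∀ i, cb t i ∈ Set.Icc (0 : ℝ) 1 := fun t ht i => by
    have hc' : ∀ s ∈ Finset.range (t + 1), c s i ∈ Set.Icc (0 : ℝ) 1 := fun s hs =>
      hc s (by rw [Finset.mem_range] at hs; omega) i
    rw [hcb t ht]
    refine ⟨div_nonneg (Finset.sum_nonneg fun s hs => (hc' s hs).1) (by positivity), ?_⟩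
    refine div_le_one_of_le₀ ?_ (by positivity)
    simpa using Finset.sum_le_sum fun s hs => (hc' s hs).2
  have hw : ∀ t ≤ T, ∀ i, 0 < w t i := by
    intro t
    induction t with
    | zero => simp [hw0]
    | succ t ih =>
      intro ht i
      rw [hwrec t ht]
      exact mul_pos (ih (by omega) i) (Real.exp_pos _)
  have hpcb : ∀ t < T, ∑ i, p t i * cb t i ∈ Set.Icc (0 : ℝ) 1 := fun t ht => by
    have hW : 0 < ∑ i, w t i :=
      Finset.sum_pos (fun i _ => hw t ht.le i) Finset.univ_nonempty
    have hp0 : ∀ i, 0 ≤ p t i := fun i => by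
      rw [hp t ht]
      exact (div_pos (hw t ht.le i) hW).le
    have hp1 : ∑ i, p t i = 1 := by
      simp_rw [hp t ht]
      rw [← Finset.sum_div, div_self hW.ne']
    refine ⟨Finset.sum_nonneg fun i _ => mul_nonneg (hp0 i) (hcbmem t ht i).1, ?_⟩
    rw [← hp1]
    exact Finset.sum_le_sum fun i _ => mul_le_of_le_one_right (hp0 i) (hcbmem t ht i).2
  have hprimal := exponential_weights_regret (x := fun t i => r t i + lam t * cb t i)
    (b := fun t => 1 + lam t) (fun t ht i => by
      have hl := hlam t ht
      obtain ⟨hr0, hr1⟩ := hr t ht i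
      obtain ⟨hc0, hc1⟩ := hcbmem t ht i
      exact ⟨by positivity, add_le_add hr1 (mul_le_of_le_one_right hl hc1)⟩)
    hw0 hp hwrec hq hq1
  have hdual := regularized_gradient_descent_regret (a := α 0)
    (y := fun t => (∑ i, p t i * cb t i) + α t - c0) hη hδ hδη (fun t ht => by
      have hα := hαpos t ht
      have hα0 := hαmono 0 t (Nat.zero_le t) ht
      obtain ⟨h0, h1⟩ := hpcb t ht
      obtain ⟨hc0, hc1⟩ := hc0
      constructor <;> linarith) hlam0 hlamrec hlamb
  have hsplit : ∑ t ∈ Finset.range T,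
      (∑ i, q i * (r t i + lam t * cb t i) - ∑ i, p t i * (r t i + lam t * cb t i)) ≤
      Real.log K / η + η / 4 * ∑ t ∈ Finset.range T, (1 + lam t ^ 2) := by
    refine le_of_mul_le_mul_left (hprimal.trans ?_) hη
    rw [Fintype.card_fin, mul_add, mul_div_cancel₀ _ hη.ne', Finset.mul_sum, Finset.mul_sum]
    gcongr with t
    nlinarith [mul_nonneg (sq_nonneg η) (sq_nonneg (lam t - 1))]
  have hexpand (v : Fin K → ℝ) (t : ℕ) : ∑ i, v i * (r t i + lam t * cb t i) =
      ∑ i, v i * r t i + lam t * ∑ i, v i * cb t i := by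
    rw [Finset.mul_sum, ← Finset.sum_add_distrib]
    exact Finset.sum_congr rfl fun i _ => by ring
  simp_rw [hexpand] at hsplit
  simp only [Finset.sum_add_distrib, Finset.sum_const, Finset.card_range, nsmul_eq_mul,
    sub_mul, mul_sub, mul_add, Finset.sum_sub_distrib, ← Finset.mul_sum] at hsplit hdual ⊢
  linarith
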